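/- Let τ_A, τ_B > 0, μ ∈ ℝ, σ > 0, and let Z be a random variable with the Asymmetric Laplace–Gaussian distribution ALG(τ_A, τ_B, μ, σ). Then the third central moment E[(Z − E[Z])³] is strictly positive if and only if τ_B > τ_A, is zero if and only if τ_B = τ_A, and is strictly negative if and only if τ_B < τ_A; that is, the ALG model is positively skewed, symmetric-skewness, or negatively skewed exactly according to the comparison of τ_B with τ_A. -/

import Mathlib

open MeasureTheory ProbabilityTheory Real Filter

/-- The Ex-Gaussian distribution `ExG(μ, σ, τ)`: the law of `N + E` where `N` is Gaussian with
mean `μ` and variance `σ²` and `E` is exponential with mean `τ` (rate `1/τ`), independent. -/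
noncomputable def ExG (μ σ τ : ℝ) : Measure ℝ :=
  (gaussianReal μ (σ ^ 2).toNNReal).conv (expMeasure τ⁻¹)

/-- The Asymmetric Laplace distribution `AL(α₁, α₂)`: the law of `E₂ - E₁` where `E₁, E₂` are
independent exponentials with means `α₁` and `α₂` respectively. -/
noncomputable def AL (α₁ α₂ : ℝ) : Measure ℝ :=
  (expMeasure α₂⁻¹).conv ((expMeasure α₁⁻¹).map (fun x => -x))

/-- The Asymmetric Laplace–Gaussian distribution `ALG(α₁, α₂, μ, σ)`: the law of `L + N` where
`L ~ AL(α₁, α₂)` and `N` is Gaussian with mean `μ` and variance `σ²`, independent. -/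
noncomputable def ALG (α₁ α₂ μ σ : ℝ) : Measure ℝ :=
  (AL α₁ α₂).conv (gaussianReal μ (σ ^ 2).toNNReal)

/-- The standard normal cumulative distribution function `Φ`. -/
noncomputable def stdNormCDF (x : ℝ) : ℝ := ((gaussianReal 0 1) (Set.Iic x)).toReal

/-- `ν` is a probability measure with finite third moment, mean `m`, variance `v`,
third cumulant `k`. -/
structure HasCumulants (ν : Measure ℝ) (m v k : ℝ) : Prop where
  prob : IsProbabilityMeasure ν
  i1 : Integrable (fun x : ℝ => x) ν
  i2 : Integrable (fun x : ℝ => x ^ 2) ν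
  i3 : Integrable (fun x : ℝ => x ^ 3) ν
  m1 : ∫ x, x ∂ν = m
  m2 : ∫ x, x ^ 2 ∂ν = v + m ^ 2
  m3 : ∫ x, x ^ 3 ∂ν = k + 3 * m * v + m ^ 3

lemma HasCumulants.neg {ν : Measure ℝ} {m v k : ℝ} (h : HasCumulants ν m v k) :
    HasCumulants (ν.map (fun x => -x)) (-m) v (-k) := by
  have hp := h.prob
  have hm : AEMeasurable (fun x : ℝ => -x) ν := by fun_prop
  refine ⟨Measure.isProbabilityMeasure_map hm, ?_, ?_, ?_, ?_, ?_, ?_⟩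
  · rw [integrable_map_measure (by fun_prop) hm]
    exact h.i1.neg
  · rw [integrable_map_measure (by fun_prop) hm]
    exact h.i2.congr (ae_of_all _ fun x => by simp)
  · rw [integrable_map_measure (by fun_prop) hm]
    exact h.i3.neg.congr (ae_of_all _ fun x => by simp only [Pi.neg_apply, Function.comp]; ring)
  · rw [integral_map hm (by fun_prop), integral_neg, h.m1]
  · rw [integral_map hm (by fun_prop)]
    simp only [neg_sq]
    rw [h.m2]
  · rw [integral_map hm (by fun_prop)]
    have : ∀ x : ℝ, (-x) ^ 3 = - x ^ 3 := fun x => by ring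
    simp only [this]
    rw [integral_neg, h.m3]; ring

lemma HasCumulants.conv {ν ν' : Measure ℝ} {m v k m' v' k' : ℝ} (h : HasCumulants ν m v k)
    (h' : HasCumulants ν' m' v' k') :
    HasCumulants (ν.conv ν') (m + m') (v + v') (k + k') := by
  have hp := h.prob
  have hp' := h'.prob
  have hm : AEMeasurable (fun x : ℝ × ℝ => x.1 + x.2) (ν.prod ν') := by fun_prop
  have c : Integrable (fun _ : ℝ => (1 : ℝ)) ν := integrable_const _
  have c' : Integrable (fun _ : ℝ => (1 : ℝ)) ν' := integrable_const _
  have a10 := h.i1.mul_prod c'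
  have a01 := c.mul_prod h'.i1
  have a20 := h.i2.mul_prod c'
  have a11 := h.i1.mul_prod h'.i1
  have a02 := c.mul_prod h'.i2
  have a30 := h.i3.mul_prod c'
  have a21 := h.i2.mul_prod h'.i1
  have a12 := h.i1.mul_prod h'.i2
  have a03 := c.mul_prod h'.i3
  have e1 : (fun z : ℝ × ℝ => z.1 + z.2) = fun z => z.1 * 1 + 1 * z.2 := by
    funext z; ring
  have e2 : (fun z : ℝ × ℝ => (z.1 + z.2) ^ 2) =
      fun z => (z.1 ^ 2 * 1 + 2 * (z.1 * z.2)) + 1 * z.2 ^ 2 := by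
    funext z; ring
  have e3 : (fun z : ℝ × ℝ => (z.1 + z.2) ^ 3) =
      fun z => ((z.1 ^ 3 * 1 + 3 * (z.1 ^ 2 * z.2)) + 3 * (z.1 * z.2 ^ 2)) + 1 * z.2 ^ 3 := by
    funext z; ring
  have o : ∫ _ : ℝ, (1 : ℝ) ∂ν = 1 := by simp
  have o' : ∫ _ : ℝ, (1 : ℝ) ∂ν' = 1 := by simp
  refine ⟨Measure.isProbabilityMeasure_map hm, ?_, ?_, ?_, ?_, ?_, ?_⟩
  · rw [Measure.conv, integrable_map_measure (by fun_prop) hm]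
    exact (a10.add a01).congr (ae_of_all _ fun x => by simp)
  · rw [Measure.conv, integrable_map_measure (by fun_prop) hm]
    change Integrable (fun z : ℝ × ℝ => (z.1 + z.2) ^ 2) _
    rw [e2]
    exact (a20.fun_add (a11.const_mul 2)).add a02
  · rw [Measure.conv, integrable_map_measure (by fun_prop) hm]
    change Integrable (fun z : ℝ × ℝ => (z.1 + z.2) ^ 3) _
    rw [e3]
    exact ((a30.fun_add (a21.const_mul 3)).fun_add (a12.const_mul 3)).add a03
  · rw [Measure.conv, integral_map hm (by fun_prop), e1, integral_add a10 a01,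
      integral_prod_mul (fun x : ℝ => x) (fun _ : ℝ => (1 : ℝ)),
      integral_prod_mul (fun _ : ℝ => (1 : ℝ)) (fun x : ℝ => x), o, o', h.m1, h'.m1]
    ring
  · rw [Measure.conv, integral_map hm (by fun_prop), e2,
      integral_add (a20.fun_add (a11.const_mul 2)) a02,
      integral_add a20 (a11.const_mul 2), integral_const_mul,
      integral_prod_mul (fun x : ℝ => x ^ 2) (fun _ : ℝ => (1 : ℝ)),
      integral_prod_mul (fun x : ℝ => x) (fun x : ℝ => x),
      integral_prod_mul (fun _ : ℝ => (1 : ℝ)) (fun x : ℝ => x ^ 2),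
      o, o', h.m1, h'.m1, h.m2, h'.m2]
    ring
  · rw [Measure.conv, integral_map hm (by fun_prop), e3,
      integral_add ((a30.fun_add (a21.const_mul 3)).fun_add (a12.const_mul 3)) a03,
      integral_add (a30.fun_add (a21.const_mul 3)) (a12.const_mul 3),
      integral_add a30 (a21.const_mul 3), integral_const_mul, integral_const_mul,
      integral_prod_mul (fun x : ℝ => x ^ 3) (fun _ : ℝ => (1 : ℝ)),
      integral_prod_mul (fun x : ℝ => x ^ 2) (fun x : ℝ => x),
      integral_prod_mul (fun x : ℝ => x) (fun x : ℝ => x ^ 2),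
      integral_prod_mul (fun _ : ℝ => (1 : ℝ)) (fun x : ℝ => x ^ 3),
      o, o', h.m1, h'.m1, h.m2, h'.m2, h.m3, h'.m3]
    ring

lemma HasCumulants.central {ν : Measure ℝ} {m v k : ℝ} (h : HasCumulants ν m v k) :
    ∫ x, (x - m) ^ 3 ∂ν = k := by
  have hp := h.prob
  have e : (fun x : ℝ => (x - m) ^ 3) =
      fun x => ((x ^ 3 + (-3 * m) * x ^ 2) + (3 * m ^ 2) * x) + (- m ^ 3) := by
    funext x; ring
  rw [e, integral_add ((h.i3.fun_add (h.i2.const_mul _)).fun_add (h.i1.const_mul _)) (integrable_const _),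
    integral_add (h.i3.fun_add (h.i2.const_mul _)) (h.i1.const_mul _),
    integral_add h.i3 (h.i2.const_mul _), integral_const_mul, integral_const_mul,
    h.m1, h.m2, h.m3]
  simp
  ring

lemma hasCumulants_gaussian (μ : ℝ) (s : NNReal) :
    HasCumulants (gaussianReal μ s) μ s 0 := by
  have i : ∀ n : ℕ, Integrable (fun x : ℝ => x ^ n) (gaussianReal μ s) := fun n =>
    by
    refine integrable_pow_of_mem_interior_integrableExpSet (X := fun x : ℝ => x) ?_ n
    simp [integrableExpSet_fun_id_gaussianReal]
  have i1 : Integrable (fun x : ℝ => x) (gaussianReal μ s) := by simpa using i 1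
  have m1 : ∫ x, x ∂(gaussianReal μ s) = μ := integral_id_gaussianReal
  have m2 : ∫ x, x ^ 2 ∂(gaussianReal μ s) = s + μ ^ 2 := by
    have := variance_eq_sub (memLp_id_gaussianReal' (μ := μ) (v := s) 2 (by simp))
    rw [variance_id_gaussianReal] at this
    simp only [id, Pi.pow_apply, m1] at this
    linarith
  have e : (gaussianReal μ s).map (fun x => 2 * μ - x) = gaussianReal μ s := by
    rw [gaussianReal_map_const_sub]
    congr 1; ring
  have key : ∫ x, x ^ 3 ∂(gaussianReal μ s) = ∫ x, (2 * μ - x) ^ 3 ∂(gaussianReal μ s) := by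
    conv_lhs => rw [← e]
    rw [integral_map (by fun_prop) (by fun_prop)]
  have e3 : (fun x : ℝ => (2 * μ - x) ^ 3) =
      fun x => ((- x ^ 3 + (6 * μ) * x ^ 2) + (-12 * μ ^ 2) * x) + (8 * μ ^ 3) := by
    funext x; ring
  rw [e3, integral_add (((i 3).fun_neg.fun_add ((i 2).const_mul _)).fun_add (i1.const_mul _))
      (integrable_const _),
    integral_add ((i 3).fun_neg.fun_add ((i 2).const_mul _)) (i1.const_mul _),
    integral_add (i 3).fun_neg ((i 2).const_mul _), integral_const_mul, integral_const_mul,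
    integral_neg, m1, m2] at key
  simp at key
  exact ⟨inferInstance, i1, i 2, i 3, m1, m2, by linarith⟩

lemma integral_pow_exp {r : ℝ} (hr : 0 < r) (n : ℕ) :
    ∫ x, x ^ n ∂(expMeasure r) = n.factorial / r ^ n := by
  rw [expMeasure, gammaMeasure, integral_withDensity_eq_integral_toReal_smul
    (f := gammaPDF 1 r)
    ((measurable_gammaPDFReal 1 r).ennreal_ofReal)
    (ae_of_all _ fun x => ENNReal.ofReal_lt_top)]
  have : ∀ x, (gammaPDF 1 r x).toReal • x ^ n =
      (Set.Ici (0 : ℝ)).indicator (fun x => r * (x ^ ((n + 1 : ℝ) - 1) * exp (-(r * x)))) x := by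
    intro x
    rw [gammaPDF, ENNReal.toReal_ofReal (gammaPDFReal_nonneg one_pos hr x), gammaPDFReal]
    by_cases hx : 0 ≤ x
    · simp [hx]; ring
    · simp [hx]
  simp only [this]
  rw [integral_indicator measurableSet_Ici, integral_Ici_eq_integral_Ioi, integral_const_mul,
    Real.integral_rpow_mul_exp_neg_mul_Ioi (by positivity) hr, Real.Gamma_nat_eq_factorial,
    Real.rpow_add_one (by positivity), Real.rpow_natCast, one_div, inv_pow]
  field_simp

lemma hasCumulants_exp {t : ℝ} (ht : 0 < t) :
    HasCumulants (expMeasure t⁻¹) t (t ^ 2) (2 * t ^ 3) := by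
  have hr : 0 < t⁻¹ := by positivity
  have i : ∀ n : ℕ, Integrable (fun x : ℝ => x ^ n) (expMeasure t⁻¹) := fun n => by
    by_contra hc
    have h := integral_pow_exp hr n
    rw [integral_undef hc] at h
    have : (0 : ℝ) < n.factorial / t⁻¹ ^ n := by positivity
    linarith
  have m1 := integral_pow_exp hr 1
  have m2 := integral_pow_exp hr 2
  have m3 := integral_pow_exp hr 3
  refine ⟨isProbabilityMeasure_expMeasure hr, by simpa using i 1, i 2, i 3,
    by simpa using m1, ?_, ?_⟩
  · rw [m2]; simp [Nat.factorial]; ring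
  · rw [m3]; simp [Nat.factorial]; ring


/-- if `Z ~ ALG(τ_A, τ_B, μ, σ)` then the third central moment of `Z` is
positive iff `τ_B > τ_A`, zero iff `τ_B = τ_A`, and negative iff `τ_B < τ_A`. -/
theorem ALG_skewness_sign {Ω : Type*} [MeasurableSpace Ω]
    (P : Measure Ω) [IsProbabilityMeasure P]
    (τA τB μ σ : ℝ) (hτA : 0 < τA) (hτB : 0 < τB) (hσ : 0 < σ)
    (Z : Ω → ℝ) (hZ : Measurable Z) (hlawZ : P.map Z = ALG τA τB μ σ) :
    (0 < (∫ ω, (Z ω - ∫ ω', Z ω' ∂P) ^ 3 ∂P) ↔ τA < τB) ∧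
    ((∫ ω, (Z ω - ∫ ω', Z ω' ∂P) ^ 3 ∂P) = 0 ↔ τB = τA) ∧
    ((∫ ω, (Z ω - ∫ ω', Z ω' ∂P) ^ 3 ∂P) < 0 ↔ τB < τA) := by

  have h : HasCumulants (P.map Z) (τB + -τA + μ)
      (τB ^ 2 + τA ^ 2 + ((σ ^ 2).toNNReal : ℝ)) (2 * τB ^ 3 + -(2 * τA ^ 3) + 0) := by
    rw [hlawZ]
    exact ((hasCumulants_exp hτB).conv (hasCumulants_exp hτA).neg).conv
      (hasCumulants_gaussian μ (σ ^ 2).toNNReal)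
  have hm : ∫ ω', Z ω' ∂P = τB + -τA + μ := by
    rw [← h.m1, integral_map hZ.aemeasurable (by fun_prop)]
  have h3 : ∫ ω, (Z ω - ∫ ω', Z ω' ∂P) ^ 3 ∂P = 2 * (τB ^ 3 - τA ^ 3) := by
    rw [hm]
    have := h.central
    rw [integral_map hZ.aemeasurable (by fun_prop)] at this
    rw [this]; ring
  have lt_iff : ∀ a b : ℝ, 0 < a → 0 < b → (a ^ 3 < b ^ 3 ↔ a < b) := fun a b ha hb =>
    pow_lt_pow_iff_left₀ ha.le hb.le (by norm_num)
  rw [h3]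
  refine ⟨?_, ?_, ?_⟩
  · rw [← lt_iff _ _ hτA hτB]; constructor <;> intro <;> linarith
  · rw [← pow_left_inj₀ hτB.le hτA.le (by norm_num : 3 ≠ 0)]; constructor <;> intro <;> linarith
  · rw [← lt_iff _ _ hτB hτA]; constructor <;> intro <;> linarith
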